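/- arXiv:math/0409351 — 2 statements merged into one kernel-verified Lean document; each statement's English description precedes it below -/
import Mathlib

section
/- Let a_1, …, a_n be integers with n even, and suppose the sequence is palindromic, i.e. a_i = a_{n+1−i} for all i. Let α and β be the (1,1)- and (2,1)-entries of P(a_1, …, a_n). Then β² ≡ −1 (mod α). (This is the source of the achirality criterion: a 2-bridge knot S(α,β) arising from a palindromic even presentation satisfies β² ≡ −1 mod α.) -/
/-- The 2×2 integer matrix `[[a,1],[1,0]]` associated to a continued-fraction term. -/
def M (a : ℤ) : Matrix (Fin 2) (Fin 2) ℤ := !![a, 1; 1, 0]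

/-- `P [a₁, …, aₙ] = M a₁ * M a₂ * ⋯ * M aₙ`, the identity for the empty list. -/
def P (l : List ℤ) : Matrix (Fin 2) (Fin 2) ℤ := (l.map M).prod

theorem M_transpose (a : ℤ) : (M a).transpose = M a := by
  ext i j
  fin_cases i <;> fin_cases j <;> rfl

theorem P_reverse (l : List ℤ) : P l.reverse = (P l).transpose := by
  simp only [P, Matrix.transpose_list_prod, List.map_map, List.map_reverse]
  congr 3
  funext a
  exact (M_transpose a).symm

theorem det_P (l : List ℤ) : (P l).det = (-1) ^ l.length := by
  induction l with
  | nil => simp [P]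
  | cons a l ih =>
    have h : P (a :: l) = M a * P l := by simp [P]
    rw [h, Matrix.det_mul, ih, List.length_cons, pow_succ']
    simp [M, Matrix.det_fin_two]

/-- For a palindromic sequence of even length, the numerator `α` and denominator `β`
of the slope satisfy `β² ≡ −1 (mod α)` — the achirality criterion. -/
theorem stmt_5 (l : List ℤ) (hpal : l.reverse = l) (hlen : Even l.length) :
    (P l 1 0) ^ 2 ≡ -1 [ZMOD (P l 0 0)] := by
  have hsymm : P l 0 1 = P l 1 0 := by
    have h := P_reverse l
    rw [hpal] at h
    exact congrFun (congrFun h 0) 1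
  have hdet := det_P l
  rw [hlen.neg_one_pow, Matrix.det_fin_two, hsymm] at hdet
  refine Int.ModEq.symm (Int.modEq_iff_dvd.mpr ⟨P l 1 1, ?_⟩)
  linear_combination -hdet
end

section
/- Let α and β be coprime integers with α odd, α > 0, β even, and 0 < |β| < α. Then there exists exactly one finite sequence a_1, …, a_n of nonzero even integers such that the continued fraction [a_1,…,a_n] = a_1 + 1/(a_2 + 1/(⋯ + 1/a_n)) equals α/β; moreover, this n is necessarily even. -/
/-- The value of the finite continued fraction `[a₁, …, aₙ] = a₁ + 1/(a₂ + 1/(⋯ + 1/aₙ))`,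
with the convention `cf [] = 0` (note that for a one-term list `cf [a] = a`, since
`(0 : ℚ)⁻¹ = 0`). -/
def cf : List ℤ → ℚ
  | [] => 0
  | a :: t => a + (cf t)⁻¹

theorem abs_inv_cf_lt_one (l : List ℤ) (hl : ∀ a ∈ l, a ≠ 0 ∧ Even a) :
    |(cf l)⁻¹| < 1 := by
  induction l with
  | nil => simp [cf]
  | cons a t ih =>
    have ht := ih fun b hb => hl b (List.mem_cons_of_mem a hb)
    obtain ⟨ha0, c, hc⟩ := hl a List.mem_cons_self
    have ha : (2 : ℤ) ≤ |a| := by rcases abs_cases a with h | h <;> omega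
    have ha' : (2 : ℚ) ≤ |(a : ℚ)| := by exact_mod_cast ha
    have htri := abs_sub_abs_le_abs_sub (a : ℚ) (-(cf t)⁻¹)
    rw [abs_neg, sub_neg_eq_add] at htri
    rw [abs_inv]
    exact inv_lt_one_of_one_lt₀ (by rw [cf]; linarith)

theorem cf_cons_ne_zero (a : ℤ) (t : List ℤ) (hl : ∀ b ∈ a :: t, b ≠ 0 ∧ Even b) :
    cf (a :: t) ≠ 0 := by
  intro h
  have ht := abs_inv_cf_lt_one t fun b hb => hl b (List.mem_cons_of_mem a hb)
  obtain ⟨ha0, -⟩ := hl a List.mem_cons_self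
  have ha : (1 : ℚ) ≤ |(a : ℚ)| := by exact_mod_cast Int.one_le_abs ha0
  rw [cf] at h
  rw [eq_neg_of_add_eq_zero_left h, abs_neg] at ha
  linarith

/-- A continued fraction with nonzero even terms is determined by its value. -/
theorem cf_injective_of_even (l m : List ℤ) (hl : ∀ a ∈ l, a ≠ 0 ∧ Even a)
    (hm : ∀ a ∈ m, a ≠ 0 ∧ Even a) (h : cf l = cf m) : l = m := by
  induction l generalizing m with
  | nil =>
    cases m with
    | nil => rfl
    | cons b u => exact absurd h.symm (cf_cons_ne_zero b u hm)
  | cons a t ih =>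
    cases m with
    | nil => exact absurd h (cf_cons_ne_zero a t hl)
    | cons b u =>
      have ht' := fun c hc => hl c (List.mem_cons_of_mem a hc)
      have hu' := fun c hc => hm c (List.mem_cons_of_mem b hc)
      have ht := abs_lt.mp (abs_inv_cf_lt_one t ht')
      have hu := abs_lt.mp (abs_inv_cf_lt_one u hu')
      obtain ⟨-, c, hc⟩ := hl a List.mem_cons_self
      obtain ⟨-, d, hd⟩ := hm b List.mem_cons_self
      rw [cf, cf] at h
      have h1 : (a : ℚ) < ((b + 2 : ℤ) : ℚ) := by push_cast; linarith
      have h2 : (b : ℚ) < ((a + 2 : ℤ) : ℚ) := by push_cast; linarith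
      have h1' : a < b + 2 := by exact_mod_cast h1
      have h2' : b < a + 2 := by exact_mod_cast h2
      have hab : a = b := by omega
      subst hab
      rw [ih u ht' hu' (inv_injective (add_left_cancel h))]

/-- Division with even quotient, for integers of opposite parity. -/
theorem exists_even_quotient (p q : ℤ) (hq : q ≠ 0) (hpq : Odd (p + q)) :
    ∃ a r : ℤ, Even a ∧ p = a * q + r ∧ |r| < |q| := by
  have hdiv := Int.mul_ediv_add_emod p q
  have hs0 := Int.emod_nonneg p hq
  have hs1 := Int.emod_lt_abs p hq
  rcases Int.even_or_odd (p / q) with hk | hk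
  · exact ⟨p / q, p % q, hk, by linarith, by rwa [abs_of_nonneg hs0]⟩
  · have hs : p % q ≠ 0 := by
      intro h
      have hp : p + q = q * (p / q + 1) := by linarith
      rw [hp, Int.odd_mul] at hpq
      exact (Int.not_even_iff_odd.mpr hpq.2) hk.add_one
    rcases lt_or_gt_of_ne hq with hneg | hpos
    · rw [abs_of_neg hneg] at hs1
      refine ⟨p / q - 1, p % q + q, hk.sub_odd odd_one, by linarith, ?_⟩
      rw [abs_of_neg hneg, abs_lt]
      constructor <;> omega
    · rw [abs_of_pos hpos] at hs1
      refine ⟨p / q + 1, p % q - q, hk.add_one, by linarith, ?_⟩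
      rw [abs_of_pos hpos, abs_lt]
      constructor <;> omega

theorem exists_even_cf_eq_div (p q : ℤ) (hq : q ≠ 0) (hpq : Odd (p + q)) (hlt : |q| < |p|) :
    ∃ l : List ℤ, (∀ a ∈ l, a ≠ 0 ∧ Even a) ∧ cf l = (p : ℚ) / (q : ℚ) ∧
      (Even l.length ↔ Even q) := by
  induction hn : q.natAbs using Nat.strong_induction_on generalizing p q with
  | _ n ih =>
    obtain ⟨a, r, ha, hp, hr⟩ := exists_even_quotient p q hq hpq
    have ha0 : a ≠ 0 := by
      rintro rfl
      rw [zero_mul, zero_add] at hp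
      subst hp
      exact lt_asymm hlt hr
    have hqr : Odd (q + r) := by
      have h : p + q = a * q + (q + r) := by linarith
      rw [h] at hpq
      exact (Int.odd_add'.mp hpq).mpr (ha.mul_right q)
    have hq' : (q : ℚ) ≠ 0 := by exact_mod_cast hq
    by_cases hr0 : r = 0
    · subst hr0
      rw [add_zero] at hqr hp
      refine ⟨[a], by simpa using ⟨ha0, ha⟩, ?_, ?_⟩
      · rw [hp]
        push_cast
        simp [cf, hq']
      · simpa using hqr
    · obtain ⟨l, hl, hcf, hlen⟩ := ih r.natAbs (by zify [← hn]; exact hr) q r hr0 hqr hr rfl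
      refine ⟨a :: l, ?_, ?_, ?_⟩
      · intro b hb
        rcases List.mem_cons.mp hb with rfl | hb
        · exact ⟨ha0, ha⟩
        · exact hl b hb
      · rw [cf, hcf, hp, inv_div]
        push_cast
        field_simp
      · rw [List.length_cons, Nat.even_add_one, hlen, Int.not_even_iff_odd]
        rw [add_comm] at hqr
        exact Int.odd_add.mp hqr

/-- For coprime integers `α, β` with `α` odd and positive, `β` even and `0 < |β| < α`,
there is exactly one finite sequence of nonzero even integers whose continued fraction
equals `α/β`; moreover any such sequence has even length. -/
theorem stmt_8 (α β : ℤ) (hco : IsCoprime α β) (hα : Odd α) (hαpos : 0 < α)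
    (hβ : Even β) (hβ0 : 0 < |β|) (hβα : |β| < α) :
    (∃! l : List ℤ, (∀ a ∈ l, a ≠ 0 ∧ Even a) ∧ cf l = (α : ℚ) / (β : ℚ)) ∧
    (∀ l : List ℤ, ((∀ a ∈ l, a ≠ 0 ∧ Even a) ∧ cf l = (α : ℚ) / (β : ℚ)) →
      Even l.length) := by
  have hlt : |β| < |α| := by rwa [abs_of_pos hαpos]
  obtain ⟨l, hl, hcf, hlen⟩ :=
    exists_even_cf_eq_div α β (abs_pos.mp hβ0) (hα.add_even hβ) hlt
  have huniq : ∀ m : List ℤ,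
      ((∀ a ∈ m, a ≠ 0 ∧ Even a) ∧ cf m = (α : ℚ) / (β : ℚ)) → m = l :=
    fun m hm => cf_injective_of_even m l hm.1 hl (hm.2.trans hcf.symm)
  refine ⟨⟨l, ⟨hl, hcf⟩, huniq⟩, fun m hm => ?_⟩
  rw [huniq m hm]
  exact hlen.mpr hβ
end
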